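/- arXiv:2409.01202 — 5 statements merged into one kernel-verified Lean document; each statement's English description precedes it below -/
import Mathlib

section
/- Let (Λ,B) be an even negative definite lattice and let e₁, e₂ ∈ Λ satisfy B(e₁,e₁) = B(e₂,e₂) = −2. If e₁ − e₂ ∈ 2Λ (i.e. e₁ and e₂ have the same class in Λ/2Λ), then e₂ = e₁ or e₂ = −e₁. -/
/-- In an even negative definite lattice `(Λ, B)`, two roots
(`B e e = -2`) that are congruent modulo `2Λ` coincide up to sign. -/
theorem stmt_0 {Λ : Type*} [AddCommGroup Λ] [Module ℤ Λ]
    [Module.Free ℤ Λ] [Module.Finite ℤ Λ]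
    (B : LinearMap.BilinForm ℤ Λ)
    (hsymm : ∀ x y, B x y = B y x)
    (heven : ∀ x : Λ, (2 : ℤ) ∣ B x x)
    (hneg : ∀ x : Λ, x ≠ 0 → B x x < 0)
    (e₁ e₂ : Λ)
    (h₁ : B e₁ e₁ = -2) (h₂ : B e₂ e₂ = -2)
    (hmod : ∃ z : Λ, e₁ - e₂ = (2 : ℤ) • z) :
    e₂ = e₁ ∨ e₂ = -e₁ := by
  obtain ⟨z, hz⟩ := hmod
  have he : e₂ = e₁ - (z + z) := by
    rw [← two_zsmul, ← hz]
    abel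
  have hBz : B e₁ z = B z z := by
    rw [he] at h₂
    simp only [map_sub, map_add, LinearMap.sub_apply, LinearMap.add_apply, h₁,
      hsymm z e₁] at h₂
    linarith
  -- By the parallelogram law, the half-difference and half-sum have squares adding up to `-2`.
  have hw : B (e₁ - z) (e₁ - z) = -2 - B z z := by
    simp only [map_sub, LinearMap.sub_apply, h₁, hsymm z e₁, hBz]
    ring
  by_cases hz0 : z = 0
  · left
    rw [he, hz0, add_zero, sub_zero]
  by_cases hw0 : e₁ - z = 0
  · right
    rw [he, ← sub_eq_zero.mp hw0]
    abel
  have := hneg z hz0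
  have := hneg _ hw0
  have := heven z
  omega
end

section
/- Let Λ be the E8 lattice: ℤ^8 with B(x,y) = −xᵀCy, where C is the Cartan matrix of E8 (Mathlib's CartanMatrix.E₈). For every v ∈ Λ such that B(v,v)/2 is odd, there exists e ∈ Λ with B(e,e) = −2 and v − e ∈ 2Λ; moreover there are exactly two such e and they are negatives of each other. Equivalently, every class in Λ/2Λ with q₀ = 1 is represented by exactly one pair ±e of roots. -/
open Matrix

/-- The bilinear form of the E8 lattice on `ℤ^8`: `B x y = -xᵀ C y` with `C`
the Cartan matrix of E8. -/
def E8form (x y : Fin 8 → ℤ) : ℤ := -(x ⬝ᵥ (CartanMatrix.E₈ *ᵥ y))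

/-- Half the norm of a vector of the E8 lattice, with the positive sign. -/
def E8halfNorm (x : Fin 8 → ℤ) : ℤ :=
  x 0 * x 0 + x 1 * x 1 + x 2 * x 2 + x 3 * x 3 + x 4 * x 4 + x 5 * x 5 + x 6 * x 6 + x 7 * x 7
    - (x 0 * x 2 + x 1 * x 3 + x 2 * x 3 + x 3 * x 4 + x 4 * x 5 + x 5 * x 6 + x 6 * x 7)

theorem E8form_self (x : Fin 8 → ℤ) : E8form x x = -2 * E8halfNorm x := by
  simp only [E8form, E8halfNorm, CartanMatrix.E₈, dotProduct, mulVec, Fin.sum_univ_eight]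
  simp
  ring

/-- The quadratic form of E8 as a positive combination of squares. -/
theorem E8halfNorm_sum_sq (x : Fin 8 → ℤ) :
    120 * E8halfNorm x = 30 * (2 * x 0 - x 2) ^ 2 + 30 * (2 * x 1 - x 3) ^ 2
      + 10 * (3 * x 2 - 2 * x 3) ^ 2 + 30 * (2 * x 7 - x 6) ^ 2 + 10 * (3 * x 6 - 2 * x 5) ^ 2
      + 5 * (4 * x 5 - 3 * x 4) ^ 2 + 3 * (5 * x 4 - 4 * x 3) ^ 2 + 2 * x 3 ^ 2 := by
  unfold E8halfNorm
  ring

theorem E8halfNorm_nonneg (x : Fin 8 → ℤ) : 0 ≤ E8halfNorm x := by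
  have h : 0 ≤ 120 * E8halfNorm x := by
    rw [E8halfNorm_sum_sq]
    positivity
  lia

theorem eq_zero_of_E8halfNorm_eq_zero {x : Fin 8 → ℤ} (hx : E8halfNorm x = 0) : x = 0 := by
  have h := E8halfNorm_sum_sq x
  rw [hx, mul_zero] at h
  have s0 := sq_nonneg (2 * x 0 - x 2)
  have s1 := sq_nonneg (2 * x 1 - x 3)
  have s2 := sq_nonneg (3 * x 2 - 2 * x 3)
  have s3 := sq_nonneg (x 3)
  have s4 := sq_nonneg (5 * x 4 - 4 * x 3)
  have s5 := sq_nonneg (4 * x 5 - 3 * x 4)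
  have s6 := sq_nonneg (3 * x 6 - 2 * x 5)
  have s7 := sq_nonneg (2 * x 7 - x 6)
  have t0 : 2 * x 0 - x 2 = 0 := sq_eq_zero_iff.mp (by linarith)
  have t1 : 2 * x 1 - x 3 = 0 := sq_eq_zero_iff.mp (by linarith)
  have t2 : 3 * x 2 - 2 * x 3 = 0 := sq_eq_zero_iff.mp (by linarith)
  have t3 : x 3 = 0 := sq_eq_zero_iff.mp (by linarith)
  have t4 : 5 * x 4 - 4 * x 3 = 0 := sq_eq_zero_iff.mp (by linarith)
  have t5 : 4 * x 5 - 3 * x 4 = 0 := sq_eq_zero_iff.mp (by linarith)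
  have t6 : 3 * x 6 - 2 * x 5 = 0 := sq_eq_zero_iff.mp (by linarith)
  have t7 : 2 * x 7 - x 6 = 0 := sq_eq_zero_iff.mp (by linarith)
  ext i
  fin_cases i <;> simp <;> lia

theorem E8halfNorm_add_add_sub (x y : Fin 8 → ℤ) :
    E8halfNorm (x + y) + E8halfNorm (x - y) = 2 * E8halfNorm x + 2 * E8halfNorm y := by
  simp only [E8halfNorm, Pi.add_apply, Pi.sub_apply]
  ring

theorem E8halfNorm_two_smul (x : Fin 8 → ℤ) :
    E8halfNorm ((2 : ℤ) • x) = 4 * E8halfNorm x := by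
  simp only [E8halfNorm, Pi.smul_apply, smul_eq_mul]
  ring

theorem E8halfNorm_add_two_smul_emod_two (x y : Fin 8 → ℤ) :
    E8halfNorm (x + (2 : ℤ) • y) % 2 = E8halfNorm x % 2 := by
  have h := E8halfNorm_add_add_sub (x + y) y
  have h' := E8halfNorm_add_add_sub x y
  have e : x + y + y = x + (2 : ℤ) • y := by rw [two_smul, add_assoc]
  rw [e, add_sub_cancel_right] at h
  lia

/-- Two roots congruent modulo twice the lattice agree up to sign. -/
theorem eq_or_eq_neg_of_E8halfNorm_eq_one {e f z : Fin 8 → ℤ} (he : E8halfNorm e = 1)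
    (hf : E8halfNorm f = 1) (h : f - e = (2 : ℤ) • z) : f = e ∨ f = -e := by
  have hsum : f + e = (2 : ℤ) • (z + e) := by
    rw [smul_add, ← h, two_smul]
    abel
  have key := E8halfNorm_add_add_sub f e
  rw [hsum, h, E8halfNorm_two_smul, E8halfNorm_two_smul, he, hf] at key
  have h₁ := E8halfNorm_nonneg z
  have h₂ := E8halfNorm_nonneg (z + e)
  obtain h0 | h0 : E8halfNorm z = 0 ∨ E8halfNorm (z + e) = 0 := by lia
  · left
    rwa [eq_zero_of_E8halfNorm_eq_zero h0, smul_zero, sub_eq_zero] at h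
  · right
    rwa [eq_zero_of_E8halfNorm_eq_zero h0, smul_zero, add_eq_zero_iff_eq_neg] at hsum

/-- Translations reducing every `0`-`1` vector of odd half-norm to a root. -/
def E8shifts : List (Fin 8 → ℤ) :=
  [![0, 0, 0, 0, 0, 0, 0, 0], ![0, 0, 0, -1, 0, 0, 0, 0], ![1, 1, 1, 1, 1, 1, 1, 1],
   ![1, 1, 1, 2, 1, 1, 1, 1], ![1, 1, 1, 2, 2, 1, 1, 1], ![0, 0, 0, -1, -1, 0, 0, 0],
   ![0, 0, -1, -1, -1, 0, 0, 0], ![0, -1, -1, -2, -2, -1, -1, 0], ![1, 1, 2, 2, 2, 1, 1, 1],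
   ![0, 0, -1, -1, 0, 0, 0, 0], ![0, 0, 0, -1, -1, -1, 0, 0], ![0, 0, -1, -1, -1, -1, 0, 0],
   ![-1, -1, -1, -2, -2, -1, -1, 0], ![1, 1, 1, 2, 2, 2, 1, 1], ![0, -1, -1, -1, -1, 0, 0, 0],
   ![0, -1, -1, -1, -1, -1, 0, 0], ![0, -1, -1, -2, -1, -1, 0, 0],
   ![-1, -1, -2, -2, -2, -1, -1, 0], ![-1, -1, -2, -3, -2, -1, -1, 0],
   ![-1, -1, -2, -3, -2, -2, -1, 0], ![1, 1, 2, 2, 2, 2, 1, 1], ![0, 0, 0, -1, -1, -1, -1, 0],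
   ![-1, -1, -1, -2, -1, -1, 0, 0], ![-1, -1, -2, -3, -2, -2, -1, -1]]

theorem exists_E8shift (a b c d e f g h : Fin 2) :
    let x : Fin 8 → ℤ := ![a.val, b.val, c.val, d.val, e.val, f.val, g.val, h.val]
    E8halfNorm x % 2 = 1 → ∃ z ∈ E8shifts, E8halfNorm (x - (2 : ℤ) • z) = 1 := by
  revert a b c d e f g h
  decide +kernel

theorem exists_E8halfNorm_eq_one {v : Fin 8 → ℤ} (hv : E8halfNorm v % 2 = 1) :
    ∃ e z : Fin 8 → ℤ, E8halfNorm e = 1 ∧ v - e = (2 : ℤ) • z := by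
  let r (i : Fin 8) : Fin 2 := ⟨(v i % 2).toNat, by lia⟩
  have hr (i : Fin 8) : ((r i).val : ℤ) = v i % 2 := Int.toNat_of_nonneg (by lia)
  have key := exists_E8shift (r 0) (r 1) (r 2) (r 3) (r 4) (r 5) (r 6) (r 7)
  have hx : ![((r 0).val : ℤ), (r 1).val, (r 2).val, (r 3).val, (r 4).val, (r 5).val,
      (r 6).val, (r 7).val] = fun i => v i % 2 := by
    ext i
    fin_cases i <;> exact hr _
  simp only [hx] at key
  have hdiv : v = (fun i => v i % 2) + (2 : ℤ) • fun i => v i / 2 := by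
    ext i
    simp only [Pi.add_apply, Pi.smul_apply, smul_eq_mul]
    lia
  rw [hdiv, E8halfNorm_add_two_smul_emod_two] at hv
  obtain ⟨z, -, hz⟩ := key hv
  refine ⟨_, (fun i => v i / 2) + z, hz, ?_⟩
  nth_rewrite 1 [hdiv]
  rw [smul_add]
  abel

/-- In the E8 lattice, every vector `v` with `B v v / 2` odd is
congruent mod `2Λ` to a root `e` (`B e e = -2`), and the roots in its class are
exactly the pair `±e` (with `e ≠ -e`). -/
theorem stmt_3 (v : Fin 8 → ℤ) (hv : (E8form v v / 2) % 2 = 1) :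
    ∃ e : Fin 8 → ℤ,
      E8form e e = -2 ∧ (∃ z : Fin 8 → ℤ, v - e = (2 : ℤ) • z) ∧ e ≠ -e ∧
      ∀ e' : Fin 8 → ℤ, E8form e' e' = -2 → (∃ z : Fin 8 → ℤ, v - e' = (2 : ℤ) • z) →
        e' = e ∨ e' = -e := by
  rw [E8form_self] at hv
  obtain ⟨e, z, he, hz⟩ := exists_E8halfNorm_eq_one (v := v) (by lia)
  refine ⟨e, by rw [E8form_self, he]; rfl, ⟨z, hz⟩, fun hneg => ?_, fun e' he' ⟨z', hz'⟩ => ?_⟩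
  · rw [self_eq_neg.mp hneg] at he
    simp [E8halfNorm] at he
  · rw [E8form_self] at he'
    refine eq_or_eq_neg_of_E8halfNorm_eq_one (z := z - z') he (by lia) ?_
    rw [smul_sub, ← hz, ← hz']
    abel
end

section
/- Let Λ be the E8 lattice: ℤ^8 with B(x,y) = −xᵀCy, where C is the Cartan matrix of E8 (Mathlib's CartanMatrix.E₈). The number of classes v ∈ Λ/2Λ with q₀(v) = 1 is exactly 120. -/
open Matrix

/-- The submodule `2Λ ⊆ Λ`. -/
def twoSub (M : Type*) [AddCommGroup M] [Module ℤ M] : Submodule ℤ M :=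
  LinearMap.range ((2 : ℤ) • (LinearMap.id : M →ₗ[ℤ] M))

/-- The quotient `Λ/2Λ` for the E8 lattice. -/
abbrev V8 : Type := (Fin 8 → ℤ) ⧸ twoSub (Fin 8 → ℤ)

/-- `q₀(c) = 1`, expressed via a representative: the class `c` contains a vector `v`
with `B v v / 2` odd. -/
def q0one (c : V8) : Prop :=
  ∃ v : Fin 8 → ℤ, Submodule.Quotient.mk v = c ∧ (E8form v v / 2) % 2 = 1

/-- The negative of the Tits form of the E8 Dynkin diagram, over a commutative ring. -/
def dynkinE8 {R : Type*} [CommRing R] (x : Fin 8 → R) : R :=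
  x 0 * x 2 + x 2 * x 3 + x 1 * x 3 + x 3 * x 4 + x 4 * x 5 + x 5 * x 6 + x 6 * x 7
    - (x 0 ^ 2 + x 1 ^ 2 + x 2 ^ 2 + x 3 ^ 2 + x 4 ^ 2 + x 5 ^ 2 + x 6 ^ 2 + x 7 ^ 2)

theorem E8form_self_s4 (v : Fin 8 → ℤ) : E8form v v = 2 * dynkinE8 v := by
  simp [E8form, dynkinE8, CartanMatrix.E₈, dotProduct, mulVec, Fin.sum_univ_succ]
  ring

theorem map_dynkinE8 {R S : Type*} [CommRing R] [CommRing S] (f : R →+* S) (x : Fin 8 → R) :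
    f (dynkinE8 x) = dynkinE8 (f ∘ x) := by
  simp [dynkinE8]

/-- Coordinatewise reduction modulo 2. -/
def reduceTwo (ι : Type*) : (ι → ℤ) →ₗ[ℤ] (ι → ZMod 2) :=
  LinearMap.compLeft (Int.castAddHom (ZMod 2)).toIntLinearMap ι

theorem reduceTwo_apply {ι : Type*} (v : ι → ℤ) : reduceTwo ι v = Int.castRingHom (ZMod 2) ∘ v :=
  rfl

theorem reduceTwo_surjective (ι : Type*) : Function.Surjective (reduceTwo ι) :=
  (ZMod.intCast_surjective (n := 2)).comp_left

theorem ker_reduceTwo (ι : Type*) : LinearMap.ker (reduceTwo ι) = twoSub (ι → ℤ) := by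
  ext v
  simp only [LinearMap.mem_ker, twoSub, LinearMap.mem_range, reduceTwo_apply, funext_iff,
    Function.comp_apply, Pi.zero_apply, eq_intCast, ZMod.intCast_zmod_eq_zero_iff_dvd]
  constructor
  · intro h
    choose w hw using h
    exact ⟨w, fun i => by simp [hw]⟩
  · rintro ⟨w, hw⟩ i
    exact ⟨w i, by simp [← hw]⟩

/-- The identification of `Λ/2Λ` with `𝔽₂^8` by coordinates modulo 2. -/
noncomputable def V8equiv : V8 ≃ₗ[ℤ] (Fin 8 → ZMod 2) :=
  (Submodule.quotEquivOfEq _ _ (ker_reduceTwo (Fin 8)).symm).trans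
    ((reduceTwo (Fin 8)).quotKerEquivOfSurjective (reduceTwo_surjective _))

theorem V8equiv_mk (v : Fin 8 → ℤ) :
    V8equiv (Submodule.Quotient.mk v) = reduceTwo (Fin 8) v := rfl

theorem E8form_half_odd_iff (v : Fin 8 → ℤ) :
    (E8form v v / 2) % 2 = 1 ↔ dynkinE8 (reduceTwo (Fin 8) v) = 1 := by
  rw [E8form_self_s4, Int.mul_ediv_cancel_left _ two_ne_zero, reduceTwo_apply, ← map_dynkinE8,
    eq_intCast, ← Int.odd_iff, ZMod.intCast_eq_one_iff_odd]

theorem q0one_iff (c : V8) : q0one c ↔ dynkinE8 (V8equiv c) = 1 := by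
  constructor
  · rintro ⟨v, rfl, hv⟩
    rwa [V8equiv_mk, ← E8form_half_odd_iff]
  · obtain ⟨v, rfl⟩ := Submodule.Quotient.mk_surjective _ c
    intro h
    exact ⟨v, rfl, (E8form_half_odd_iff v).2 h⟩

theorem card_dynkinE8_eq_one :
    Fintype.card {x : Fin 8 → ZMod 2 // dynkinE8 x = 1} = 120 := by
  decide +kernel

/-- For the E8 lattice, exactly 120 classes in `Λ/2Λ` have `q₀ = 1`. -/
theorem stmt_4 : Nat.card {c : V8 // q0one c} = 120 := by
  rw [Nat.card_congr (V8equiv.toEquiv.subtypeEquiv (q := (dynkinE8 · = 1)) q0one_iff),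
    Nat.card_eq_fintype_card, card_dynkinE8_eq_one]
end

section
/- Let (Λ,B) be an even lattice and let e₁, …, eₙ ∈ Λ with n ≤ 3 be pairwise orthogonal roots: B(eᵢ,eᵢ) = −2 for all i and B(eᵢ,eⱼ) = 0 for i ≠ j. Then the ℤ-span S of e₁, …, eₙ is a primitive submodule of Λ: for every x ∈ Λ and every nonzero integer m, if m·x ∈ S then x ∈ S. -/
theorem even_of_four_dvd_sum_sq {n : ℕ} (hn : n ≤ 3) (b : Fin n → ℤ)
    (h : (4 : ℤ) ∣ ∑ i, b i ^ 2) (i : Fin n) : (2 : ℤ) ∣ b i := by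
  have sq_mod : ∀ z : ℤ, (2 ∣ z ∧ z ^ 2 % 4 = 0) ∨ z ^ 2 % 4 = 1 := by
    intro z
    rcases Int.even_or_odd' z with ⟨k, rfl | rfl⟩
    · exact Or.inl ⟨⟨k, rfl⟩, by ring_nf; omega⟩
    · exact Or.inr (by ring_nf; omega)
  have hb := fun j => sq_mod (b j)
  interval_cases n
  · exact i.elim0
  all_goals
    simp only [Fin.sum_univ_succ, Fin.forall_fin_succ, Fin.sum_univ_zero] at h hb
    revert i
    simp only [Fin.forall_fin_succ]
    simp only [IsEmpty.forall_iff, and_true] at *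
    omega


/-- In an even lattice `(Λ, B)`, the span of at most 3 pairwise
orthogonal roots (`B eᵢ eᵢ = -2`, `B eᵢ eⱼ = 0` for `i ≠ j`) is a primitive
submodule: whenever `m • x` lies in the span for some nonzero integer `m`, so
does `x`. -/
theorem stmt_13 {Λ : Type*} [AddCommGroup Λ] [Module ℤ Λ]
    [Module.Free ℤ Λ] [Module.Finite ℤ Λ]
    (B : LinearMap.BilinForm ℤ Λ)
    (hsymm : ∀ x y, B x y = B y x)
    (heven : ∀ x : Λ, (2 : ℤ) ∣ B x x)
    (n : ℕ) (hn : n ≤ 3) (e : Fin n → Λ)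
    (hroot : ∀ i, B (e i) (e i) = -2)
    (horth : ∀ i j, i ≠ j → B (e i) (e j) = 0) :
    ∀ (x : Λ) (m : ℤ), m ≠ 0 →
      m • x ∈ Submodule.span ℤ (Set.range e) → x ∈ Submodule.span ℤ (Set.range e) := by
  obtain rfl : ‹Module ℤ Λ› = AddCommGroup.toIntModule Λ := Subsingleton.elim _ _
  intro x m hm hx
  obtain ⟨a, ha⟩ := (Submodule.mem_span_range_iff_exists_fun ℤ).1 hx
  have coeff : ∀ i, m * B x (e i) = -2 * a i := by
    intro i
    have h := congrArg (fun y => B y (e i)) ha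
    simp only [map_sum, map_smul, LinearMap.sum_apply, LinearMap.smul_apply, smul_eq_mul] at h
    rw [Finset.sum_eq_single i (fun j _ hj => by rw [horth j i hj, mul_zero]) (by simp),
      hroot] at h
    linarith
  have two_smul_eq : (2 : ℤ) • x = -∑ i, B x (e i) • e i := by
    apply smul_right_injective Λ hm
    change m • (2 : ℤ) • x = m • -∑ i, B x (e i) • e i
    rw [smul_comm, ← ha, smul_neg, Finset.smul_sum, Finset.smul_sum, ← Finset.sum_neg_distrib]
    refine Finset.sum_congr rfl fun i _ => ?_
    rw [smul_smul, smul_smul, coeff, ← neg_smul]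
    congr 1
    ring
  have sum_sq : 2 * B x x = -∑ i, B x (e i) ^ 2 := by
    have h := congrArg (B x) two_smul_eq
    simpa only [map_neg, map_sum, map_smul, smul_eq_mul, ← sq] using h
  have even_coeff := even_of_four_dvd_sum_sq hn (fun i => B x (e i)) (by
    obtain ⟨k, hk⟩ := heven x
    exact ⟨-k, by linarith⟩)
  choose c hc using even_coeff
  have hxc : x = -∑ i, c i • e i := by
    apply smul_right_injective Λ (two_ne_zero : (2 : ℤ) ≠ 0)
    change (2 : ℤ) • x = (2 : ℤ) • -∑ i, c i • e i
    rw [two_smul_eq, smul_neg, Finset.smul_sum]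
    simp only [smul_smul, ← hc]
  rw [hxc]
  exact Submodule.neg_mem _ (Submodule.sum_mem _ fun i _ =>
    Submodule.smul_mem _ _ (Submodule.subset_span ⟨i, rfl⟩))
end

section
/- Fix p ≥ 0 and let G = (ℤ/2ℤ) × (ℤ × ℤ)^p × ℤ. For parameters k̄ ∈ ℤ/2ℤ, m ∈ ℤ^p and κ ∈ {0,1}^p ⊆ ℤ^p, define T(k̄,m,κ) : G → G by T(k̄,m,κ)(f, ((βᵢ,ωᵢ))ᵢ, l) = (f + Σᵢ(κᵢβᵢ + mᵢωᵢ mod 2) + k̄·(l mod 2), (((−1)^{κᵢ}βᵢ − 2mᵢωᵢ + mᵢl, (−1)^{κᵢ}ωᵢ + κᵢl))ᵢ, l). Then for all parameter tuples (k̄₁,m₁,κ₁) and (k̄₂,m₂,κ₂): T(k̄₁,m₁,κ₁)(k̄₂, ((m₂ᵢ, κ₂ᵢ))ᵢ, 1) = (k̄, ((m'ᵢ, κ'ᵢ))ᵢ, 1), where for each i: κ'ᵢ is the element of {0,1} with κ'ᵢ ≡ κ₁ᵢ + κ₂ᵢ (mod 2), m'ᵢ = (−1)^{κ₁ᵢ}m₂ᵢ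 + (−1)^{κ₂ᵢ}m₁ᵢ, and k̄ = k̄₁ + k̄₂ + Σᵢ(κ₁ᵢm₂ᵢ + κ₂ᵢm₁ᵢ) (mod 2). -/
/-- The action of an element of the real Mordell–Weil group on
`H₁(X_ℝ) = ℤ/2 × (ℤ × ℤ)^p × ℤ`, with parameters `k̄ ∈ ℤ/2`, `m ∈ ℤ^p` and
`κ ∈ {0,1}^p ⊆ ℤ^p`:
`T(f, ((βᵢ, ωᵢ))ᵢ, l) = (f + Σᵢ(κᵢβᵢ + mᵢωᵢ mod 2) + k̄·(l mod 2),
 (((-1)^κᵢ βᵢ - 2mᵢωᵢ + mᵢl, (-1)^κᵢ ωᵢ + κᵢ l))ᵢ, l)`. -/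
def Tact (p : ℕ) (kb : ZMod 2) (m κ : Fin p → ℤ)
    (x : ZMod 2 × (Fin p → ℤ × ℤ) × ℤ) : ZMod 2 × (Fin p → ℤ × ℤ) × ℤ :=
  (x.1 + (∑ i : Fin p, ((κ i * (x.2.1 i).1 + m i * (x.2.1 i).2 : ℤ) : ZMod 2))
      + kb * ((x.2.2 : ℤ) : ZMod 2),
   fun i =>
     ((((-1 : ℤˣ) ^ (κ i) : ℤˣ) : ℤ) * (x.2.1 i).1 - 2 * m i * (x.2.1 i).2 + m i * x.2.2,
      (((-1 : ℤˣ) ^ (κ i) : ℤˣ) : ℤ) * (x.2.1 i).2 + κ i * x.2.2),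
   x.2.2)

/-- Composition rule: applying `T(k̄₁, m₁, κ₁)` to the vector
`(k̄₂, ((m₂ᵢ, κ₂ᵢ))ᵢ, 1)` yields `(k̄, ((m'ᵢ, κ'ᵢ))ᵢ, 1)` where `κ'ᵢ ∈ {0,1}`
with `κ'ᵢ ≡ κ₁ᵢ + κ₂ᵢ (mod 2)`, `m'ᵢ = (-1)^{κ₁ᵢ} m₂ᵢ + (-1)^{κ₂ᵢ} m₁ᵢ`, and
`k̄ = k̄₁ + k̄₂ + Σᵢ(κ₁ᵢ m₂ᵢ + κ₂ᵢ m₁ᵢ) (mod 2)`. -/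
theorem stmt_16 (p : ℕ) (kb₁ kb₂ : ZMod 2) (m₁ m₂ κ₁ κ₂ : Fin p → ℤ)
    (hκ₁ : ∀ i, κ₁ i = 0 ∨ κ₁ i = 1) (hκ₂ : ∀ i, κ₂ i = 0 ∨ κ₂ i = 1) :
    ∃ κ' : Fin p → ℤ,
      (∀ i, κ' i = 0 ∨ κ' i = 1) ∧
      (∀ i, ((κ' i : ℤ) : ZMod 2) = ((κ₁ i : ℤ) : ZMod 2) + ((κ₂ i : ℤ) : ZMod 2)) ∧
      Tact p kb₁ m₁ κ₁ (kb₂, fun i => (m₂ i, κ₂ i), 1)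
        = (kb₁ + kb₂ + (∑ i : Fin p, ((κ₁ i * m₂ i + κ₂ i * m₁ i : ℤ) : ZMod 2)),
           fun i =>
             ((((-1 : ℤˣ) ^ (κ₁ i) : ℤˣ) : ℤ) * m₂ i
                + (((-1 : ℤˣ) ^ (κ₂ i) : ℤˣ) : ℤ) * m₁ i,
              κ' i),
           1) := by
  refine ⟨fun i => (((-1 : ℤˣ) ^ (κ₁ i) : ℤˣ) : ℤ) * κ₂ i + κ₁ i, fun i => ?_, fun i => ?_, ?_⟩
  · rcases hκ₁ i with h₁ | h₁ <;> rcases hκ₂ i with h₂ | h₂ <;> simp [h₁, h₂]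
  · rcases hκ₁ i with h₁ | h₁ <;> rcases hκ₂ i with h₂ | h₂ <;> simp [h₁, h₂]
    decide
  · refine Prod.ext ?_ (Prod.ext (funext fun i => Prod.ext ?_ ?_) rfl)
    · simp only [Tact, Int.cast_one, mul_one, mul_comm (m₁ _)]
      ring
    · rcases hκ₂ i with h₂ | h₂ <;> simp [Tact, h₂]
      ring
    · simp [Tact]
end
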